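/- arXiv:2507.11881 — 2 statements merged into one kernel-verified Lean document; each statement's English description precedes it below -/
import Mathlib

section
/- Let s > 3/2 and s−1 ≤ s' ≤ s+1. There exists a constant C > 0, depending only on s and s', such that for every Schwartz vector field u : ℝ³ → ℝ³ one has ∥(u·∇)u∥_{H^{s'−1}} ≤ C ∥u∥_{H^{s'}} ∥∇u∥_{H^{s'}}. -/
open MeasureTheory SchwartzMap Real
open scoped FourierTransform

noncomputable section

/-- `ℝ³` as a Euclidean space. -/
abbrev E3 : Type := EuclideanSpace ℝ (Fin 3)

/-- The (squared-integral based) Sobolev `H^σ` norm of a complex-valued function on `ℝ³`,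
defined via the Fourier transform. -/
noncomputable def HNorm (σ : ℝ) (f : E3 → ℂ) : ℝ :=
  (∫ ξ : E3, (1 + ‖ξ‖ ^ 2) ^ σ * ‖𝓕 f ξ‖ ^ 2) ^ ((1 : ℝ) / 2)

/-- The Sobolev `H^σ` norm of a real-valued function. -/
noncomputable def HNormR (σ : ℝ) (f : E3 → ℝ) : ℝ :=
  HNorm σ (fun x => (f x : ℂ))

/-- The `j`-th partial derivative of a real-valued function on `ℝ³`. -/
noncomputable def pdR (j : Fin 3) (f : E3 → ℝ) : E3 → ℝ :=
  fun x => fderiv ℝ f x (EuclideanSpace.single j 1)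

/-- The `j`-th partial derivative of a complex-valued function on `ℝ³`. -/
noncomputable def pdC (j : Fin 3) (f : E3 → ℂ) : E3 → ℂ :=
  fun x => fderiv ℝ f x (EuclideanSpace.single j 1)

/-- The Sobolev `H^σ` norm of a vector field `u : ℝ³ → ℝ³`:
`∥u∥_{H^σ}² = Σ_i ∥u_i∥_{H^σ}²`. -/
noncomputable def VNorm (σ : ℝ) (u : Fin 3 → E3 → ℝ) : ℝ :=
  (∑ i : Fin 3, (HNormR σ (u i)) ^ 2) ^ ((1 : ℝ) / 2)

/-- `∥∇u∥_{H^σ}² = Σ_{i,j} ∥∂_j u_i∥_{H^σ}²` for a vector field `u : ℝ³ → ℝ³`. -/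
noncomputable def GradVNorm (σ : ℝ) (u : Fin 3 → E3 → ℝ) : ℝ :=
  (∑ i : Fin 3, ∑ j : Fin 3, (HNormR σ (pdR j (u i))) ^ 2) ^ ((1 : ℝ) / 2)

/-- The advection term `(u·∇)v`, with components `Σ_j u_j ∂_j v_i`. -/
noncomputable def adv (u v : Fin 3 → E3 → ℝ) : Fin 3 → E3 → ℝ :=
  fun i x => ∑ j : Fin 3, u j x * pdR j (v i) x

/-- The pointwise cross product of two vector fields on `ℝ³`. -/
noncomputable def crossVF (u v : Fin 3 → E3 → ℝ) : Fin 3 → E3 → ℝ :=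
  fun i x =>
    ![u 1 x * v 2 x - u 2 x * v 1 x,
      u 2 x * v 0 x - u 0 x * v 2 x,
      u 0 x * v 1 x - u 1 x * v 0 x] i

/-- A Schwartz vector field, viewed as a plain vector field. -/
noncomputable def toVF (u : Fin 3 → SchwartzMap E3 ℝ) : Fin 3 → E3 → ℝ :=
  fun i => ⇑(u i)

lemma rpow_le_of_quasi_triangle_of_le {A B C τ : ℝ} (hA : 0 < A) (hB : 0 < B) (hC : 0 < C)
    (hτ : 0 ≤ τ) (hAC : A ≤ 2 * (B + C)) (hBA : B ≤ A) (hBC : B ≤ C) :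
    A ^ (τ - 1 / 2) ≤ 4 ^ τ * B ^ (-(1 / 2 + τ)) * (B ^ τ * C ^ τ) := by
  have h1 : A ^ τ ≤ 4 ^ τ * C ^ τ := by
    rw [← Real.mul_rpow (by norm_num) hC.le]
    exact Real.rpow_le_rpow hA.le (by linarith) hτ
  have h2 : A ^ (-(1 / 2) : ℝ) ≤ B ^ (-(1 / 2) : ℝ) :=
    Real.rpow_le_rpow_of_nonpos hB hBA (by norm_num)
  calc A ^ (τ - 1 / 2) = A ^ τ * A ^ (-(1 / 2) : ℝ) := by
        rw [← Real.rpow_add hA]; ring_nf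
    _ ≤ (4 ^ τ * C ^ τ) * B ^ (-(1 / 2) : ℝ) := by gcongr
    _ = 4 ^ τ * (B ^ (-(1 / 2 + τ)) * B ^ τ) * C ^ τ := by
        rw [← Real.rpow_add hB]; ring_nf
    _ = _ := by ring

/-- If three positive numbers satisfy a quasi-triangle inequality, the kernel
`A ^ (τ - 1/2) * B ^ (-τ) * C ^ (-τ)` is controlled by powers of a single one of them. -/
lemma rpow_le_of_quasi_triangle {A B C τ : ℝ} (hA : 0 < A) (hB : 0 < B) (hC : 0 < C)
    (hτ : 0 ≤ τ) (hABC : A ≤ 2 * (B + C)) :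
    A ^ (τ - 1 / 2) ≤ 4 ^ τ *
      (A ^ (-(1 / 2 + τ)) + B ^ (-(1 / 2 + τ)) + C ^ (-(1 / 2 + τ))) * (B ^ τ * C ^ τ) := by
  have hA' := Real.rpow_pos_of_pos hA (-(1 / 2 + τ))
  have hB' := Real.rpow_pos_of_pos hB (-(1 / 2 + τ))
  have hC' := Real.rpow_pos_of_pos hC (-(1 / 2 + τ))
  rcases le_total A B with hAB | hAB <;> rcases le_total B C with hBC | hBC <;>
    rcases le_total A C with hAC | hAC
  case inr.inl.inl | inr.inl.inr =>
    refine (rpow_le_of_quasi_triangle_of_le hA hB hC hτ hABC hAB hBC).trans ?_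
    gcongr
    linarith
  case inl.inr.inr | inr.inr.inr | inr.inr.inl =>
    refine (rpow_le_of_quasi_triangle_of_le hA hC hB hτ (by linarith) (by linarith) hBC).trans ?_
    rw [mul_comm (C ^ τ)]
    gcongr
    linarith
  all_goals
    have h4 : (1 : ℝ) ≤ 4 ^ τ := Real.one_le_rpow (by norm_num) hτ
    calc A ^ (τ - 1 / 2) = 1 * A ^ (-(1 / 2 + τ)) * (A ^ τ * A ^ τ) := by
          rw [one_mul, ← Real.rpow_add hA, ← Real.rpow_add hA]; ring_nf
      _ ≤ _ := by
          have hAC' : A ≤ C := by linarith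
          gcongr
          linarith

/-- The weight `(1 + ‖ξ‖²) ^ (σ / 2)` as an extended nonnegative real. -/
def jWeight (σ : ℝ) (ξ : E3) : ENNReal := ENNReal.ofReal ((1 + ‖ξ‖ ^ 2) ^ (σ / 2))

lemma measurable_jWeight (σ : ℝ) : Measurable (jWeight σ) := by
  unfold jWeight
  fun_prop

lemma one_add_norm_sq_add_le (x y : E3) :
    1 + ‖x + y‖ ^ 2 ≤ 2 * ((1 + ‖x‖ ^ 2) + (1 + ‖y‖ ^ 2)) := by
  have h := norm_add_le x y
  nlinarith [norm_nonneg (x + y), sq_nonneg (‖x‖ - ‖y‖)]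

lemma jWeight_le {t : ℝ} (ht : 0 ≤ t) (ξ η : E3) :
    jWeight (t - 1) ξ ≤ ENNReal.ofReal (4 ^ (t / 2)) *
      (jWeight (-(1 + t)) ξ + jWeight (-(1 + t)) (ξ - η) + jWeight (-(1 + t)) η) *
      (jWeight t (ξ - η) * jWeight t η) := by
  have hpos : ∀ x : E3, 0 < 1 + ‖x‖ ^ 2 := fun x => by positivity
  have h1 := one_add_norm_sq_add_le (ξ - η) η
  rw [sub_add_cancel] at h1
  have key := rpow_le_of_quasi_triangle (hpos ξ) (hpos (ξ - η)) (hpos η)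
    (div_nonneg ht zero_le_two) h1
  have e1 : t / 2 - 1 / 2 = (t - 1) / 2 := by ring
  have e2 : -(1 / 2 + t / 2) = -(1 + t) / 2 := by ring
  rw [e1, e2] at key
  unfold jWeight
  have hp : ∀ (x : E3) (σ : ℝ), 0 ≤ (1 + ‖x‖ ^ 2) ^ σ := fun x σ =>
    (Real.rpow_pos_of_pos (hpos x) σ).le
  rw [← ENNReal.ofReal_add (hp _ _) (hp _ _),
    ← ENNReal.ofReal_add (add_nonneg (hp _ _) (hp _ _)) (hp _ _),
    ← ENNReal.ofReal_mul (hp _ _), ← ENNReal.ofReal_mul (by positivity),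
    ← ENNReal.ofReal_mul (by positivity)]
  exact ENNReal.ofReal_le_ofReal key

lemma jWeight_sq (σ : ℝ) (ξ : E3) :
    jWeight σ ξ ^ 2 = ENNReal.ofReal ((1 + ‖ξ‖ ^ 2) ^ σ) := by
  have h : 0 < 1 + ‖ξ‖ ^ 2 := by positivity
  rw [jWeight, ← ENNReal.ofReal_pow (by positivity), ← Real.rpow_natCast, ← Real.rpow_mul h.le]
  norm_num

lemma lintegral_jWeight_sq_lt_top {t : ℝ} (ht : 1 / 2 < t) :
    ∫⁻ ξ : E3, jWeight (-(1 + t)) ξ ^ 2 < ⊤ := by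
  have h := integrable_rpow_neg_one_add_norm_sq (E := E3) (μ := volume) (r := 2 * (1 + t))
    (by simp; linarith)
  simp_rw [jWeight_sq]
  refine lt_of_eq_of_lt ?_ h.lintegral_lt_top
  congr! 4
  ring

lemma sq_lintegral_mul_le {α : Type*} [MeasurableSpace α] {μ : Measure α} {f g : α → ENNReal}
    (hf : Measurable f) (hg : Measurable g) :
    (∫⁻ x, f x * g x ∂μ) ^ 2 ≤ (∫⁻ x, f x ^ 2 ∂μ) * ∫⁻ x, g x ^ 2 ∂μ := by
  have h := ENNReal.lintegral_mul_le_Lp_mul_Lq μ Real.HolderConjugate.two_two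
    hf.aemeasurable hg.aemeasurable
  have h2 := pow_le_pow_left' h 2
  simp only [Pi.mul_apply] at h2
  refine h2.trans_eq ?_
  rw [mul_pow, ← ENNReal.rpow_natCast, ← ENNReal.rpow_natCast, ← ENNReal.rpow_mul,
    ← ENNReal.rpow_mul]
  norm_num

lemma lintegral_lintegral_conv {F G : E3 → ENNReal} (hF : Measurable F) (hG : Measurable G) :
    ∫⁻ ξ, ∫⁻ η, F (ξ - η) * G η = (∫⁻ x, F x) * ∫⁻ x, G x := by
  rw [lintegral_lintegral_swap (by fun_prop)]
  simp_rw [fun η => lintegral_mul_const (μ := volume) (G η) (f := fun ξ => F (ξ - η)) (by fun_prop),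
    lintegral_sub_right_eq_self F]
  rw [lintegral_const_mul _ hG]

/-- Schur-type bound: a kernel square integrable in one variable. -/
lemma lintegral_sq_kernel_conv_le {F G : E3 → ENNReal} {k : E3 → E3 → ENNReal} {M : ENNReal}
    (hF : Measurable F) (hG : Measurable G) (hk : Measurable (Function.uncurry k))
    (hM : ∀ ξ, ∫⁻ η, k ξ η ^ 2 ≤ M) :
    ∫⁻ ξ, (∫⁻ η, k ξ η * (F (ξ - η) * G η)) ^ 2 ≤
      M * ((∫⁻ x, F x ^ 2) * ∫⁻ x, G x ^ 2) := by
  calc ∫⁻ ξ, (∫⁻ η, k ξ η * (F (ξ - η) * G η)) ^ 2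
      ≤ ∫⁻ ξ, M * ∫⁻ η, F (ξ - η) ^ 2 * G η ^ 2 := by
        refine lintegral_mono fun ξ => ?_
        refine (sq_lintegral_mul_le (hk.of_uncurry_left) (by fun_prop)).trans ?_
        simp_rw [mul_pow]
        gcongr
        exact hM ξ
    _ = _ := by
        rw [lintegral_const_mul _ (by fun_prop),
          lintegral_lintegral_conv (hF.pow_const 2) (hG.pow_const 2)]

lemma lintegral_sq_weight_mul_conv_le {F G w : E3 → ENNReal}
    (hF : Measurable F) (hG : Measurable G) (hw : Measurable w) :
    ∫⁻ ξ, (w ξ * ∫⁻ η, F (ξ - η) * G η) ^ 2 ≤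
      (∫⁻ x, w x ^ 2) * ((∫⁻ x, F x ^ 2) * ∫⁻ x, G x ^ 2) := by
  rw [← lintegral_mul_const _ (by fun_prop)]
  refine lintegral_mono fun ξ => ?_
  rw [mul_pow]
  gcongr
  refine (sq_lintegral_mul_le (by fun_prop) hG).trans_eq ?_
  rw [lintegral_sub_left_eq_self (fun x => F x ^ 2)]

lemma ENNReal.add_three_sq_le (a b c : ENNReal) :
    (a + b + c) ^ 2 ≤ 3 * (a ^ 2 + b ^ 2 + c ^ 2) := by
  by_cases h : a = ⊤ ∨ b = ⊤ ∨ c = ⊤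
  · rcases h with h | h | h <;> simp [h]
  push Not at h
  obtain ⟨ha, hb, hc⟩ := h
  lift a to NNReal using ha
  lift b to NNReal using hb
  lift c to NNReal using hc
  norm_cast
  rw [← NNReal.coe_le_coe]
  push_cast
  nlinarith [sq_nonneg ((a : ℝ) - b), sq_nonneg ((b : ℝ) - c), sq_nonneg ((a : ℝ) - c)]

lemma lintegral_jWeight_conv_le {t : ℝ} (ht : 0 ≤ t) {f g : E3 → ENNReal}
    (hf : Measurable f) (hg : Measurable g) :
    ∫⁻ ξ, (jWeight (t - 1) ξ * ∫⁻ η, f (ξ - η) * g η) ^ 2 ≤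
      ENNReal.ofReal (4 ^ (t / 2)) ^ 2 * (9 * ∫⁻ x, jWeight (-(1 + t)) x ^ 2) *
        ((∫⁻ x, (jWeight t x * f x) ^ 2) * ∫⁻ x, (jWeight t x * g x) ^ 2) := by
  have hj := measurable_jWeight
  set w := jWeight (-(1 + t)) with hw
  have hwm : Measurable w := hj _
  set F : E3 → ENNReal := fun x => jWeight t x * f x with hF
  set G : E3 → ENNReal := fun x => jWeight t x * g x with hG
  have hFm : Measurable F := (hj t).mul hf
  have hGm : Measurable G := (hj t).mul hg
  set c := ENNReal.ofReal (4 ^ (t / 2))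
  have pt : ∀ ξ, (jWeight (t - 1) ξ * ∫⁻ η, f (ξ - η) * g η) ^ 2 ≤
      c ^ 2 * (3 * ((w ξ * ∫⁻ η, F (ξ - η) * G η) ^ 2 +
        (∫⁻ η, w (ξ - η) * (F (ξ - η) * G η)) ^ 2 + (∫⁻ η, w η * (F (ξ - η) * G η)) ^ 2)) := by
    intro ξ
    refine le_trans ?_ (mul_le_mul_right (ENNReal.add_three_sq_le _ _ _) _)
    rw [← mul_pow]
    refine pow_le_pow_left' ?_ 2
    rw [← lintegral_const_mul _ (by fun_prop), ← lintegral_const_mul _ (by fun_prop),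
      ← lintegral_add_left (by fun_prop), ← lintegral_add_left (by fun_prop),
      ← lintegral_const_mul _ (by fun_prop)]
    refine lintegral_mono fun η => ?_
    calc jWeight (t - 1) ξ * (f (ξ - η) * g η)
        ≤ (c * (w ξ + w (ξ - η) + w η) * (jWeight t (ξ - η) * jWeight t η)) *
          (f (ξ - η) * g η) := by
          gcongr
          exact jWeight_le ht ξ η
      _ = _ := by simp only [hF, hG]; ring
  refine (lintegral_mono pt).trans ?_
  have m1 : Measurable fun ξ => ∫⁻ η, F (ξ - η) * G η := by fun_prop
  have m2 : Measurable fun ξ => ∫⁻ η, w (ξ - η) * (F (ξ - η) * G η) := by fun_prop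
  have m3 : Measurable fun ξ => ∫⁻ η, w η * (F (ξ - η) * G η) := by fun_prop
  rw [lintegral_const_mul _ (by fun_prop), lintegral_const_mul _ (by fun_prop),
    lintegral_add_left (by fun_prop), lintegral_add_left (by fun_prop), mul_assoc]
  refine mul_le_mul_right ?_ _
  have b1 := lintegral_sq_weight_mul_conv_le hFm hGm hwm
  have b2 := lintegral_sq_kernel_conv_le (k := fun ξ η => w (ξ - η)) hFm hGm (by fun_prop)
    (fun ξ => (lintegral_sub_left_eq_self (fun x => w x ^ 2) ξ).le)
  have b3 := lintegral_sq_kernel_conv_le (k := fun ξ η => w η) hFm hGm (by fun_prop)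
    (fun ξ => le_rfl)
  refine (mul_le_mul_right (add_le_add (add_le_add b1 b2) b3) 3).trans_eq ?_
  ring

lemma integrable_weight_mul_fourier_sq (σ : ℝ) (f : 𝓢(E3, ℂ)) :
    Integrable fun ξ : E3 => (1 + ‖ξ‖ ^ 2) ^ σ * ‖𝓕 (f : E3 → ℂ) ξ‖ ^ 2 := by
  have hg : Function.HasTemperateGrowth (fun ξ : E3 => (1 + ‖ξ‖ ^ 2) ^ (σ / 2)) := by fun_prop
  have h := (SchwartzMap.smulLeftCLM ℂ (fun ξ : E3 => (1 + ‖ξ‖ ^ 2) ^ (σ / 2)) (𝓕 f)).memLp 2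
  refine (h.integrable_norm_pow two_ne_zero).congr (.of_forall fun ξ => ?_)
  have hpos : 0 < 1 + ‖ξ‖ ^ 2 := by positivity
  simp only [SchwartzMap.smulLeftCLM_apply_apply hg, norm_smul, mul_pow, SchwartzMap.fourier_coe]
  rw [Real.norm_of_nonneg (by positivity), ← Real.rpow_natCast, ← Real.rpow_mul hpos.le]
  norm_num

lemma HNorm_sq (σ : ℝ) (f : E3 → ℂ) :
    HNorm σ f ^ 2 = ∫ ξ : E3, (1 + ‖ξ‖ ^ 2) ^ σ * ‖𝓕 f ξ‖ ^ 2 := by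
  have : 0 ≤ ∫ ξ : E3, (1 + ‖ξ‖ ^ 2) ^ σ * ‖𝓕 f ξ‖ ^ 2 := integral_nonneg fun ξ => by positivity
  rw [HNorm, ← Real.sqrt_eq_rpow, Real.sq_sqrt this]

lemma ofReal_HNorm_sq (σ : ℝ) (f : 𝓢(E3, ℂ)) :
    ENNReal.ofReal (HNorm σ f ^ 2) = ∫⁻ ξ, (jWeight σ ξ * ‖𝓕 (f : E3 → ℂ) ξ‖ₑ) ^ 2 := by
  rw [HNorm_sq, ofReal_integral_eq_lintegral_ofReal (integrable_weight_mul_fourier_sq σ f)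
    (.of_forall fun ξ => by positivity)]
  refine lintegral_congr fun ξ => ?_
  rw [mul_pow, jWeight_sq, ENNReal.ofReal_mul (by positivity), ENNReal.ofReal_pow (norm_nonneg _),
    ofReal_norm]

/-- The product of two complex Schwartz functions. -/
def schwartzMul (f g : 𝓢(E3, ℂ)) : 𝓢(E3, ℂ) :=
  SchwartzMap.pairing (ContinuousLinearMap.mul ℂ ℂ) f g

lemma fourierInv_schwartzMul (f g : 𝓢(E3, ℂ)) (ξ : E3) :
    𝓕⁻ (schwartzMul f g : E3 → ℂ) ξ =
      ∫ η, 𝓕⁻ (f : E3 → ℂ) η * 𝓕⁻ (g : E3 → ℂ) (ξ - η) := by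
  have h := SchwartzMap.fourier_convolution (ContinuousLinearMap.mul ℂ ℂ) (𝓕⁻ f) (𝓕⁻ g)
  rw [FourierTransform.fourier_fourierInv_eq, FourierTransform.fourier_fourierInv_eq] at h
  rw [← SchwartzMap.fourierInv_coe, schwartzMul, ← h, FourierTransform.fourierInv_fourier_eq,
    SchwartzMap.convolution_apply]
  simp [MeasureTheory.convolution, SchwartzMap.fourierInv_coe]

lemma fourier_schwartzMul (f g : 𝓢(E3, ℂ)) (ξ : E3) :
    𝓕 (schwartzMul f g : E3 → ℂ) ξ = ∫ η, 𝓕 (f : E3 → ℂ) (ξ - η) * 𝓕 (g : E3 → ℂ) η := by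
  have h := fourierInv_schwartzMul f g (-ξ)
  simp only [Real.fourierInv_eq_fourier_neg, neg_neg] at h
  rw [h, ← integral_sub_right_eq_self _ ξ]
  congr! 4 <;> abel

lemma enorm_fourier_schwartzMul_le (f g : 𝓢(E3, ℂ)) (ξ : E3) :
    ‖𝓕 (schwartzMul f g : E3 → ℂ) ξ‖ₑ ≤
      ∫⁻ η, ‖𝓕 (f : E3 → ℂ) (ξ - η)‖ₑ * ‖𝓕 (g : E3 → ℂ) η‖ₑ := by
  rw [fourier_schwartzMul]
  refine (enorm_integral_le_lintegral_enorm _).trans_eq ?_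
  simp_rw [enorm_mul]

theorem exists_HNorm_schwartzMul_sq_le {t : ℝ} (ht : 1 / 2 < t) :
    ∃ K : ℝ, 0 ≤ K ∧ ∀ f g : 𝓢(E3, ℂ),
      HNorm (t - 1) (schwartzMul f g) ^ 2 ≤ K * (HNorm t f ^ 2 * HNorm t g ^ 2) := by
  set M := ENNReal.ofReal (4 ^ (t / 2)) ^ 2 * (9 * ∫⁻ x : E3, jWeight (-(1 + t)) x ^ 2) with hM
  have hMtop : M ≠ ⊤ := ENNReal.mul_ne_top (by finiteness)
    (ENNReal.mul_ne_top (by finiteness) (lintegral_jWeight_sq_lt_top ht).ne)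
  refine ⟨M.toReal, ENNReal.toReal_nonneg, fun f g => ?_⟩
  have meas : ∀ h : 𝓢(E3, ℂ), Measurable fun ξ => ‖𝓕 (h : E3 → ℂ) ξ‖ₑ := fun h => by
    rw [← SchwartzMap.fourier_coe]
    exact (𝓕 h).continuous.measurable.enorm
  have h := lintegral_jWeight_conv_le (by linarith : 0 ≤ t) (meas f) (meas g)
  rw [← ofReal_HNorm_sq, ← ofReal_HNorm_sq, ← hM] at h
  rw [← ENNReal.ofReal_le_ofReal_iff (by positivity), ofReal_HNorm_sq,
    ENNReal.ofReal_mul ENNReal.toReal_nonneg, ENNReal.ofReal_toReal hMtop,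
    ENNReal.ofReal_mul (by positivity)]
  refine le_trans (lintegral_mono fun ξ => ?_) h
  gcongr
  exact enorm_fourier_schwartzMul_le f g ξ

lemma HNorm_sum_sq_le (σ : ℝ) (f : Fin 3 → 𝓢(E3, ℂ)) :
    HNorm σ (∑ j, f j : 𝓢(E3, ℂ)) ^ 2 ≤ 3 * ∑ j, HNorm σ (f j) ^ 2 := by
  simp_rw [HNorm_sq]
  rw [← integral_finsetSum _ fun j _ => integrable_weight_mul_fourier_sq σ (f j),
    ← integral_const_mul]
  refine integral_mono (integrable_weight_mul_fourier_sq σ _)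
    ((integrable_finsetSum _ fun j _ => integrable_weight_mul_fourier_sq σ (f j)).const_mul 3)
    fun ξ => ?_
  have e : 𝓕 ((∑ j, f j : 𝓢(E3, ℂ)) : E3 → ℂ) ξ = ∑ j, 𝓕 (f j : E3 → ℂ) ξ := by
    simp_rw [← SchwartzMap.fourier_coe]
    have : 𝓕 (∑ j, f j) = ∑ j, 𝓕 (f j) :=
      map_sum (FourierTransform.fourierCLM ℂ 𝓢(E3, ℂ)) f Finset.univ
    rw [this, sum_apply]
  have hn : ‖∑ j, 𝓕 (f j : E3 → ℂ) ξ‖ ^ 2 ≤ 3 * ∑ j, ‖𝓕 (f j : E3 → ℂ) ξ‖ ^ 2 := by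
    refine (pow_le_pow_left₀ (norm_nonneg _) (norm_sum_le _ _) 2).trans ?_
    simpa using sq_sum_le_card_mul_sum_sq (s := Finset.univ) (f := fun j => ‖𝓕 (f j : E3 → ℂ) ξ‖)
  simp only [e]
  rw [← Finset.mul_sum, mul_left_comm]
  gcongr

/-- A real Schwartz function regarded as a complex one. -/
def schwartzOfReal (f : 𝓢(E3, ℝ)) : 𝓢(E3, ℂ) := f.postcompCLM (𝕜 := ℝ) Complex.ofRealCLM

/-- The partial derivative of a real Schwartz function. -/
def schwartzPd (j : Fin 3) (f : 𝓢(E3, ℝ)) : 𝓢(E3, ℝ) :=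
  LineDeriv.lineDerivOp (EuclideanSpace.single j (1 : ℝ) : E3) f

lemma coe_schwartzPd (j : Fin 3) (f : 𝓢(E3, ℝ)) : ⇑(schwartzPd j f) = pdR j f := by
  ext x
  exact SchwartzMap.lineDerivOp_apply_eq_fderiv _ f x

lemma HNormR_coe (σ : ℝ) (f : 𝓢(E3, ℝ)) : HNormR σ f = HNorm σ (schwartzOfReal f) := rfl

lemma HNormR_adv (σ : ℝ) (u : Fin 3 → 𝓢(E3, ℝ)) (i : Fin 3) :
    HNormR σ (adv (toVF u) (toVF u) i) =
      HNorm σ (∑ j, schwartzMul (schwartzOfReal (u j)) (schwartzOfReal (schwartzPd j (u i))) :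
        𝓢(E3, ℂ)) := by
  unfold HNormR
  congr 1
  ext x
  simp [adv, toVF, schwartzMul, schwartzOfReal, coe_schwartzPd]

lemma HNormR_adv_sq_le {t K : ℝ} (hK : 0 ≤ K)
    (hprod : ∀ f g : 𝓢(E3, ℂ),
      HNorm (t - 1) (schwartzMul f g) ^ 2 ≤ K * (HNorm t f ^ 2 * HNorm t g ^ 2))
    (u : Fin 3 → 𝓢(E3, ℝ)) (i : Fin 3) :
    HNormR (t - 1) (adv (toVF u) (toVF u) i) ^ 2 ≤
      3 * K * ((∑ j, HNormR t (u j) ^ 2) * ∑ j, HNormR t (pdR j (u i)) ^ 2) := by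
  rw [HNormR_adv]
  calc _ ≤ 3 * ∑ j, K * (HNormR t (u j) ^ 2 * HNormR t (pdR j (u i)) ^ 2) := by
        refine (HNorm_sum_sq_le _ _).trans ?_
        gcongr with j
        have h := hprod (schwartzOfReal (u j)) (schwartzOfReal (schwartzPd j (u i)))
        rwa [← HNormR_coe t, ← HNormR_coe t, coe_schwartzPd] at h
    _ = 3 * K * ∑ j, HNormR t (u j) ^ 2 * HNormR t (pdR j (u i)) ^ 2 := by
        rw [← Finset.mul_sum, mul_assoc]
    _ ≤ _ := by
        gcongr
        rw [Finset.sum_mul]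
        gcongr with j
        exact Finset.single_le_sum (f := fun j => HNormR t (pdR j (u i)) ^ 2)
          (fun j _ => sq_nonneg _) (Finset.mem_univ j)

/-- Lemma 2.7: `∥(u·∇)u∥_{H^{s'−1}} ≤ C ∥u∥_{H^{s'}} ∥∇u∥_{H^{s'}}`
for `s > 3/2`, `s−1 ≤ s' ≤ s+1` and Schwartz vector fields `u`. -/
theorem advection_estimate_u (s s' : ℝ) (hs : 3 / 2 < s)
    (hs'1 : s - 1 ≤ s') (hs'2 : s' ≤ s + 1) :
    ∃ C : ℝ, 0 < C ∧ ∀ u : Fin 3 → SchwartzMap E3 ℝ,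
      VNorm (s' - 1) (adv (toVF u) (toVF u)) ≤
        C * VNorm s' (toVF u) * GradVNorm s' (toVF u) := by
  obtain ⟨K, hK, hprod⟩ := exists_HNorm_schwartzMul_sq_le (t := s') (by linarith)
  refine ⟨√(3 * K) + 1, by positivity, fun u => ?_⟩
  have hsum : ∑ i, HNormR (s' - 1) (adv (toVF u) (toVF u) i) ^ 2 ≤
      3 * K * ((∑ j, HNormR s' (toVF u j) ^ 2) *
        ∑ i, ∑ j, HNormR s' (pdR j (toVF u i)) ^ 2) := by
    rw [Finset.mul_sum, Finset.mul_sum]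
    exact Finset.sum_le_sum fun i _ => HNormR_adv_sq_le hK hprod u i
  have key := Real.sqrt_le_sqrt hsum
  rw [Real.sqrt_mul (by positivity : 0 ≤ 3 * K),
    Real.sqrt_mul (by positivity : 0 ≤ ∑ j, HNormR s' (toVF u j) ^ 2)] at key
  rw [VNorm, VNorm, GradVNorm, ← Real.sqrt_eq_rpow, ← Real.sqrt_eq_rpow, ← Real.sqrt_eq_rpow]
  refine key.trans ?_
  rw [mul_assoc]
  exact mul_le_mul_of_nonneg_right (by linarith) (by positivity)

end
end

section
/- Let s > 3/2 and s−1 ≤ s' ≤ s+1. There exists a constant C > 0, depending only on s and s', such that for all Schwartz vector fields j, u : ℝ³ → ℝ³ one has ∥(j·∇)u∥_{H^{s−1}} ≤ C ∥j∥_{H^s} ∥∇u∥_{H^{s'}}. -/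
open MeasureTheory SchwartzMap Real
open scoped FourierTransform

noncomputable section

/-- The Fourier transform of a product of Schwartz functions is the convolution of their Fourier
transforms. -/
lemma fourier_mul_eq_convolution (f g : SchwartzMap E3 ℂ) (ξ : E3) :
    𝓕 (fun x => f x * g x) ξ =
      (convolution (𝓕 f : SchwartzMap E3 ℂ) (𝓕 g : SchwartzMap E3 ℂ) (ContinuousLinearMap.mul ℂ ℂ) volume) ξ := by
  set c := SchwartzMap.convolution (ContinuousLinearMap.mul ℂ ℂ) (𝓕 f) (𝓕 g) with hc
  have h : (fun x => f x * g x) = (𝓕⁻ c : SchwartzMap E3 ℂ) := by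
    ext x
    have key : ∀ h : SchwartzMap E3 ℂ, h x = (𝓕 (𝓕 h) : SchwartzMap E3 ℂ) (-x) := by
      intro h
      have h1 : h x = (𝓕⁻ (𝓕 h : SchwartzMap E3 ℂ) : SchwartzMap E3 ℂ) x := by simp
      rw [h1, SchwartzMap.fourierInv_coe, Real.fourierInv_eq_fourier_neg,
        ← SchwartzMap.fourier_coe]
    have h2 : (𝓕⁻ c : SchwartzMap E3 ℂ) x = (𝓕 c : SchwartzMap E3 ℂ) (-x) := by
      rw [SchwartzMap.fourierInv_coe, Real.fourierInv_eq_fourier_neg, ← SchwartzMap.fourier_coe]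
    rw [h2, hc, SchwartzMap.fourier_convolution, SchwartzMap.pairing_apply_apply, ← key, ← key]
    rfl
  rw [h, ← SchwartzMap.fourier_coe, FourierTransform.fourier_fourierInv_eq, hc,
    SchwartzMap.convolution_apply]

lemma integrable_weight_mul_norm_sq (σ : ℝ) (f : SchwartzMap E3 ℂ) :
    Integrable (fun ξ : E3 => (1 + ‖ξ‖ ^ 2) ^ σ * ‖f ξ‖ ^ 2) := by
  have hg := Function.hasTemperateGrowth_one_add_norm_sq_rpow E3 (σ / 2)
  have h := ((SchwartzMap.smulLeftCLM ℂ (fun x : E3 => (1 + ‖x‖ ^ 2) ^ (σ / 2)) f).memLp 2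
    volume).integrable_norm_pow (by norm_num)
  refine h.congr (Filter.Eventually.of_forall fun ξ => ?_)
  have hw : 0 < 1 + ‖ξ‖ ^ 2 := by positivity
  simp only [SchwartzMap.smulLeftCLM_apply_apply hg, norm_smul]
  rw [mul_pow, Real.norm_of_nonneg (by positivity), ← Real.rpow_mul_natCast hw.le]
  norm_num

lemma weight_mul_le {s σ : ℝ} (hσ : 0 ≤ σ) (hσs : σ ≤ s) (x y : E3) :
    (1 + ‖x + y‖ ^ 2) ^ σ * ((1 + ‖x‖ ^ 2) ^ (-s) * (1 + ‖y‖ ^ 2) ^ (-σ)) ≤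
      4 ^ σ * ((1 + ‖x‖ ^ 2) ^ (-s) + (1 + ‖y‖ ^ 2) ^ (-s)) := by
  have ha : 0 < 1 + ‖x‖ ^ 2 := by positivity
  have hb : 0 < 1 + ‖y‖ ^ 2 := by positivity
  have hxy : 1 + ‖x + y‖ ^ 2 ≤ 2 * ((1 + ‖x‖ ^ 2) + (1 + ‖y‖ ^ 2)) := by
    have h1 : ‖x + y‖ ^ 2 ≤ (‖x‖ + ‖y‖) ^ 2 := by gcongr; exact norm_add_le x y
    nlinarith [sq_nonneg (‖x‖ - ‖y‖)]
  generalize 1 + ‖x‖ ^ 2 = a at *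
  generalize 1 + ‖y‖ ^ 2 = b at *
  have hw : 0 ≤ 1 + ‖x + y‖ ^ 2 := by positivity
  generalize 1 + ‖x + y‖ ^ 2 = w at *
  have hab : 0 < a ^ (-s) := Real.rpow_pos_of_pos ha _
  have hbs : 0 < b ^ (-s) := Real.rpow_pos_of_pos hb _
  rcases le_total a b with h | h
  · have h1 : w ^ σ ≤ 4 ^ σ * b ^ σ := by
      rw [← Real.mul_rpow (by norm_num) hb.le]
      exact Real.rpow_le_rpow hw (by linarith) hσ
    calc w ^ σ * (a ^ (-s) * b ^ (-σ)) ≤ 4 ^ σ * b ^ σ * (a ^ (-s) * b ^ (-σ)) := by gcongr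
      _ = 4 ^ σ * a ^ (-s) * (b ^ σ * b ^ (-σ)) := by ring
      _ = 4 ^ σ * a ^ (-s) := by rw [← Real.rpow_add hb]; simp
      _ ≤ _ := by rw [mul_add]; linarith [show 0 < (4 : ℝ) ^ σ * b ^ (-s) by positivity]
  · have h1 : w ^ σ ≤ 4 ^ σ * a ^ σ := by
      rw [← Real.mul_rpow (by norm_num) ha.le]
      exact Real.rpow_le_rpow hw (by linarith) hσ
    have h2 : a ^ (σ - s) ≤ b ^ (σ - s) := Real.rpow_le_rpow_of_nonpos hb h (by linarith)
    calc w ^ σ * (a ^ (-s) * b ^ (-σ)) ≤ 4 ^ σ * a ^ σ * (a ^ (-s) * b ^ (-σ)) := by gcongr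
      _ = 4 ^ σ * (a ^ σ * a ^ (-s)) * b ^ (-σ) := by ring
      _ = 4 ^ σ * a ^ (σ - s) * b ^ (-σ) := by rw [← Real.rpow_add ha]; rfl
      _ ≤ 4 ^ σ * b ^ (σ - s) * b ^ (-σ) := by gcongr
      _ = 4 ^ σ * b ^ (-s) := by rw [mul_assoc, ← Real.rpow_add hb]; ring_nf
      _ ≤ _ := by rw [mul_add]; linarith [show 0 < (4 : ℝ) ^ σ * a ^ (-s) by positivity]

lemma integrable_weight_neg {s : ℝ} (hs : 3 / 2 < s) :
    Integrable (fun ξ : E3 => (1 + ‖ξ‖ ^ 2) ^ (-s)) := by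
  have h := integrable_rpow_neg_one_add_norm_sq (E := E3) (μ := volume) (r := 2 * s)
    (by simp; linarith)
  convert h using 3
  ring

/-- The Cauchy–Schwarz inequality for lower integrals, with squares. -/
lemma lintegral_mul_sq_le {α : Type*} [MeasurableSpace α] {μ : Measure α} {f g : α → ENNReal}
    (hf : AEMeasurable f μ) (hg : AEMeasurable g μ) :
    (∫⁻ a, f a * g a ∂μ) ^ 2 ≤ (∫⁻ a, f a ^ 2 ∂μ) * ∫⁻ a, g a ^ 2 ∂μ := by
  have h := ENNReal.lintegral_mul_le_Lp_mul_Lq μ Real.HolderConjugate.two_two hf hg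
  simp only [Pi.mul_apply, ENNReal.rpow_ofNat] at h
  calc _ ≤ ((∫⁻ a, f a ^ 2 ∂μ) ^ (1 / 2 : ℝ) * (∫⁻ a, g a ^ 2 ∂μ) ^ (1 / 2 : ℝ)) ^ 2 := by gcongr
    _ = _ := by
      rw [mul_pow, ← ENNReal.rpow_mul_natCast, ← ENNReal.rpow_mul_natCast]
      norm_num

/-- Pointwise weighted bound for a convolution. -/
lemma weight_mul_convolution_sq_le {s σ : ℝ} (hs : 3 / 2 < s) (hσ : 0 ≤ σ) (hσs : σ ≤ s)
    (f g : SchwartzMap E3 ℂ) (ξ : E3) :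
    ENNReal.ofReal ((1 + ‖ξ‖ ^ 2) ^ σ *
        ‖(convolution f g (ContinuousLinearMap.mul ℂ ℂ) volume) ξ‖ ^ 2) ≤
      ENNReal.ofReal (4 ^ σ * (2 * ∫ x : E3, (1 + ‖x‖ ^ 2) ^ (-s))) *
        ∫⁻ t, ENNReal.ofReal ((1 + ‖t‖ ^ 2) ^ s * ‖f t‖ ^ 2) *
          ENNReal.ofReal ((1 + ‖ξ - t‖ ^ 2) ^ σ * ‖g (ξ - t)‖ ^ 2) := by
  have hw : ∀ x : E3, 0 < 1 + ‖x‖ ^ 2 := fun x => by positivity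
  have hsq : ∀ (x : E3) (r : ℝ), ((1 + ‖x‖ ^ 2) ^ (r / 2)) ^ 2 = (1 + ‖x‖ ^ 2) ^ r := by
    intro x r
    rw [← Real.rpow_mul_natCast (hw x).le]
    norm_num
  have hinv : ∀ (x : E3) (r : ℝ), (1 + ‖x‖ ^ 2) ^ (r / 2) * (1 + ‖x‖ ^ 2) ^ (-r / 2) = 1 := by
    intro x r
    rw [← Real.rpow_add (hw x)]
    ring_nf
    simp
  set a : E3 → ENNReal := fun t => ENNReal.ofReal
    (((1 + ‖t‖ ^ 2) ^ (s / 2) * ‖f t‖) * ((1 + ‖ξ - t‖ ^ 2) ^ (σ / 2) * ‖g (ξ - t)‖)) with ha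
  set b : E3 → ENNReal := fun t => ENNReal.ofReal
    ((1 + ‖t‖ ^ 2) ^ (-s / 2) * (1 + ‖ξ - t‖ ^ 2) ^ (-σ / 2)) with hb
  have hma : Measurable a := by
    have := f.continuous.measurable
    have := g.continuous.measurable
    fun_prop
  have hmb : Measurable b := by fun_prop
  have h1 : ‖(convolution f g (ContinuousLinearMap.mul ℂ ℂ) volume) ξ‖ₑ ≤ ∫⁻ t, a t * b t := by
    refine (enorm_integral_le_lintegral_enorm _).trans (lintegral_mono fun t => le_of_eq ?_)
    rw [ha, hb]
    dsimp only
    rw [← ENNReal.ofReal_mul (by positivity), ← ofReal_norm]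
    congr 1
    rw [ContinuousLinearMap.mul_apply', norm_mul]
    linear_combination (-‖f t‖ * ‖g (ξ - t)‖ * ((1 + ‖ξ - t‖ ^ 2) ^ (σ / 2) *
      (1 + ‖ξ - t‖ ^ 2) ^ (-σ / 2))) * hinv t s - ‖f t‖ * ‖g (ξ - t)‖ * hinv (ξ - t) σ
  have h2 : ENNReal.ofReal ((1 + ‖ξ‖ ^ 2) ^ σ) * ∫⁻ t, b t ^ 2 ≤
      ENNReal.ofReal (4 ^ σ * (2 * ∫ x : E3, (1 + ‖x‖ ^ 2) ^ (-s))) := by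
    rw [← lintegral_const_mul _ (by fun_prop)]
    have hi := integrable_weight_neg hs
    have hi' := hi.comp_sub_left ξ
    have : (4 : ℝ) ^ σ * (2 * ∫ x : E3, (1 + ‖x‖ ^ 2) ^ (-s)) =
        ∫ t : E3, 4 ^ σ * ((1 + ‖t‖ ^ 2) ^ (-s) + (1 + ‖ξ - t‖ ^ 2) ^ (-s)) := by
      rw [integral_const_mul, integral_add hi hi',
        integral_sub_left_eq_self (fun x : E3 => (1 + ‖x‖ ^ 2) ^ (-s))]
      ring
    have hsum : Integrable fun t : E3 =>
        (4 : ℝ) ^ σ * ((1 + ‖t‖ ^ 2) ^ (-s) + (1 + ‖ξ - t‖ ^ 2) ^ (-s)) :=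
      (hi.add hi').const_mul _
    rw [this, ofReal_integral_eq_lintegral_ofReal hsum
      (Filter.Eventually.of_forall fun t => by dsimp only [Pi.zero_apply]; positivity)]
    refine lintegral_mono fun t => ?_
    rw [hb]
    dsimp only
    rw [← ENNReal.ofReal_pow (by positivity), ← ENNReal.ofReal_mul (by positivity), mul_pow,
      hsq, hsq]
    refine ENNReal.ofReal_le_ofReal ?_
    simpa using weight_mul_le hσ hσs t (ξ - t)
  have h3 : ∀ t, a t ^ 2 = ENNReal.ofReal ((1 + ‖t‖ ^ 2) ^ s * ‖f t‖ ^ 2) *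
          ENNReal.ofReal ((1 + ‖ξ - t‖ ^ 2) ^ σ * ‖g (ξ - t)‖ ^ 2) := by
    intro t
    rw [ha]
    dsimp only
    rw [← ENNReal.ofReal_pow (by positivity), ← ENNReal.ofReal_mul (by positivity), mul_pow,
      mul_pow, mul_pow, hsq, hsq]
  simp_rw [← h3]
  rw [ENNReal.ofReal_mul (by positivity), ENNReal.ofReal_pow (by positivity), ofReal_norm]
  calc _ ≤ ENNReal.ofReal ((1 + ‖ξ‖ ^ 2) ^ σ) * (∫⁻ t, a t * b t) ^ 2 := by gcongr
    _ ≤ ENNReal.ofReal ((1 + ‖ξ‖ ^ 2) ^ σ) * ((∫⁻ t, a t ^ 2) * ∫⁻ t, b t ^ 2) := by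
      gcongr
      exact lintegral_mul_sq_le hma.aemeasurable hmb.aemeasurable
    _ = (ENNReal.ofReal ((1 + ‖ξ‖ ^ 2) ^ σ) * ∫⁻ t, b t ^ 2) * ∫⁻ t, a t ^ 2 := by ring
    _ ≤ _ := by gcongr

/-- Weighted `L²` bound for a convolution of Schwartz functions. -/
lemma integral_weight_mul_convolution_sq_le {s σ : ℝ} (hs : 3 / 2 < s) (hσ : 0 ≤ σ)
    (hσs : σ ≤ s) (f g : SchwartzMap E3 ℂ) :
    ∫ ξ : E3, (1 + ‖ξ‖ ^ 2) ^ σ *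
        ‖(convolution f g (ContinuousLinearMap.mul ℂ ℂ) volume) ξ‖ ^ 2 ≤
      (4 ^ σ * (2 * ∫ x : E3, (1 + ‖x‖ ^ 2) ^ (-s))) *
        ((∫ ξ : E3, (1 + ‖ξ‖ ^ 2) ^ s * ‖f ξ‖ ^ 2) *
          ∫ ξ : E3, (1 + ‖ξ‖ ^ 2) ^ σ * ‖g ξ‖ ^ 2) := by
  have hmf : Measurable f := f.continuous.measurable
  have hmg : Measurable g := g.continuous.measurable
  have hc := integrable_weight_mul_norm_sq σ
    (SchwartzMap.convolution (ContinuousLinearMap.mul ℂ ℂ) f g)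
  simp_rw [SchwartzMap.convolution_apply] at hc
  have hI : 0 ≤ ∫ x : E3, (1 + ‖x‖ ^ 2) ^ (-s) := integral_nonneg fun x => by positivity
  have hF : 0 ≤ ∫ ξ : E3, (1 + ‖ξ‖ ^ 2) ^ s * ‖f ξ‖ ^ 2 := integral_nonneg fun x => by positivity
  have hG : 0 ≤ ∫ ξ : E3, (1 + ‖ξ‖ ^ 2) ^ σ * ‖g ξ‖ ^ 2 := integral_nonneg fun x => by positivity
  refine (ENNReal.ofReal_le_ofReal_iff (by positivity)).1 ?_
  rw [ENNReal.ofReal_mul (by positivity), ENNReal.ofReal_mul hF,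
    ofReal_integral_eq_lintegral_ofReal hc
      (Filter.Eventually.of_forall fun t => by dsimp only [Pi.zero_apply]; positivity),
    ofReal_integral_eq_lintegral_ofReal (integrable_weight_mul_norm_sq s f)
      (Filter.Eventually.of_forall fun t => by dsimp only [Pi.zero_apply]; positivity),
    ofReal_integral_eq_lintegral_ofReal (integrable_weight_mul_norm_sq σ g)
      (Filter.Eventually.of_forall fun t => by dsimp only [Pi.zero_apply]; positivity)]
  refine (lintegral_mono fun ξ => weight_mul_convolution_sq_le hs hσ hσs f g ξ).trans ?_
  rw [lintegral_const_mul' _ _ ENNReal.ofReal_ne_top,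
    lintegral_lintegral_swap (by fun_prop)]
  gcongr
  rw [← lintegral_mul_const _ (by fun_prop)]
  refine lintegral_mono fun t => ?_
  rw [lintegral_const_mul _ (by fun_prop),
    lintegral_sub_right_eq_self
      (fun ξ : E3 => ENNReal.ofReal ((1 + ‖ξ‖ ^ 2) ^ σ * ‖g ξ‖ ^ 2)) t]

lemma HNorm_mul_sq_le {s σ : ℝ} (hs : 3 / 2 < s) (hσ : 0 ≤ σ) (hσs : σ ≤ s)
    (f g : SchwartzMap E3 ℂ) :
    HNorm σ (fun x => f x * g x) ^ 2 ≤
      (4 ^ σ * (2 * ∫ x : E3, (1 + ‖x‖ ^ 2) ^ (-s))) * (HNorm s f ^ 2 * HNorm σ g ^ 2) := by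
  simp_rw [HNorm_sq, fourier_mul_eq_convolution]
  exact integral_weight_mul_convolution_sq_le hs hσ hσs (𝓕 f) (𝓕 g)

lemma HNorm_sq_mono {σ τ : ℝ} (h : σ ≤ τ) (f : SchwartzMap E3 ℂ) :
    HNorm σ f ^ 2 ≤ HNorm τ f ^ 2 := by
  simp_rw [HNorm_sq]
  refine integral_mono (integrable_weight_mul_norm_sq σ (𝓕 f))
    (integrable_weight_mul_norm_sq τ (𝓕 f)) fun ξ => ?_
  have : 1 ≤ 1 + ‖ξ‖ ^ 2 := by nlinarith [sq_nonneg ‖ξ‖]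
  dsimp only
  gcongr

lemma HNorm_sum_sq_le_s6 (σ : ℝ) {ι : Type*} [Fintype ι] (f : ι → SchwartzMap E3 ℂ) :
    HNorm σ (fun x => ∑ i, f i x) ^ 2 ≤ Fintype.card ι * ∑ i, HNorm σ (f i) ^ 2 := by
  have hsum : (fun x => ∑ i, f i x) = ⇑(∑ i, f i) := by
    ext x
    simp
  have hF : 𝓕 (∑ i, f i) = ∑ i, 𝓕 (f i) :=
    map_sum (FourierTransform.fourierCLM ℂ (SchwartzMap E3 ℂ)) f Finset.univ
  simp_rw [HNorm_sq, ← SchwartzMap.fourier_coe]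
  rw [← integral_finsetSum _ fun i _ => integrable_weight_mul_norm_sq σ (𝓕 (f i)),
    ← integral_const_mul, hsum, ← SchwartzMap.fourier_coe]
  refine integral_mono (integrable_weight_mul_norm_sq σ (𝓕 (∑ i, f i)))
    ((integrable_finsetSum _ fun i _ =>
      integrable_weight_mul_norm_sq σ (𝓕 (f i))).const_mul _) fun ξ => ?_
  dsimp only
  rw [hF, ← Finset.mul_sum, mul_left_comm]
  gcongr
  rw [sum_apply]
  calc _ ≤ (∑ i, ‖𝓕 (f i) ξ‖) ^ 2 := by gcongr; exact norm_sum_le _ _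
    _ ≤ _ := sq_sum_le_card_mul_sum_sq

/-- A real Schwartz function regarded as a complex one. -/
def complexify (f : SchwartzMap E3 ℝ) : SchwartzMap E3 ℂ :=
  f.postcompCLM Complex.ofRealCLM

lemma coe_complexify (f : SchwartzMap E3 ℝ) : ⇑(complexify f) = fun x => (f x : ℂ) := by
  ext x
  simp [complexify]

open scoped LineDeriv in
lemma coe_lineDerivOp (j : Fin 3) (f : SchwartzMap E3 ℝ) :
    ⇑(∂_{EuclideanSpace.single j (1 : ℝ)} f : SchwartzMap E3 ℝ) = pdR j f := by
  ext x
  rw [SchwartzMap.lineDerivOp_apply_eq_fderiv, pdR]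

open scoped LineDeriv in
lemma HNormR_adv_sq_le_s6 {s σ τ : ℝ} (hs : 3 / 2 < s) (hσ : 0 ≤ σ) (hσs : σ ≤ s) (hστ : σ ≤ τ)
    (j u : Fin 3 → SchwartzMap E3 ℝ) (i : Fin 3) :
    HNormR σ (adv (toVF j) (toVF u) i) ^ 2 ≤
      3 * (4 ^ σ * (2 * ∫ x : E3, (1 + ‖x‖ ^ 2) ^ (-s))) *
        ((∑ k, HNormR s (toVF j k) ^ 2) * ∑ k, HNormR τ (pdR k (toVF u i)) ^ 2) := by
  have hI : 0 ≤ ∫ x : E3, (1 + ‖x‖ ^ 2) ^ (-s) := integral_nonneg fun x => by positivity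
  set J : Fin 3 → SchwartzMap E3 ℂ := fun k => complexify (j k) with hJ
  set D : Fin 3 → SchwartzMap E3 ℂ := fun k =>
    complexify (∂_{EuclideanSpace.single k (1 : ℝ)} (u i)) with hD
  have hJn : ∀ k, HNormR s (toVF j k) = HNorm s (J k) := fun k => by
    rw [HNormR, hJ, coe_complexify, toVF]
  have hDn : ∀ k, HNormR τ (pdR k (toVF u i)) = HNorm τ (D k) := fun k => by
    rw [HNormR, hD, coe_complexify, toVF, coe_lineDerivOp]
  have hadv : (fun x => ((adv (toVF j) (toVF u) i x : ℝ) : ℂ)) =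
      fun x => ∑ k, SchwartzMap.pairing (ContinuousLinearMap.mul ℂ ℂ) (J k) (D k) x := by
    ext x
    simp only [adv, SchwartzMap.pairing_apply_apply, ContinuousLinearMap.mul_apply', hJ, hD,
      coe_complexify, coe_lineDerivOp, toVF]
    push_cast
    rfl
  simp_rw [hJn, hDn]
  rw [HNormR, hadv]
  refine (HNorm_sum_sq_le_s6 σ _).trans ?_
  rw [Fintype.card_fin, Nat.cast_ofNat, mul_assoc]
  refine mul_le_mul_of_nonneg_left ?_ (by norm_num)
  rw [Finset.mul_sum, Finset.mul_sum]
  refine Finset.sum_le_sum fun k _ => ?_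
  have h := HNorm_mul_sq_le hs hσ hσs (J k) (D k)
  refine le_trans (le_of_eq ?_) (h.trans ?_)
  · congr 2
  · refine mul_le_mul_of_nonneg_left (mul_le_mul ?_ (HNorm_sq_mono hστ (D k)) (sq_nonneg _)
      (Finset.sum_nonneg fun _ _ => sq_nonneg _)) (by positivity)
    exact Finset.single_le_sum (f := fun k => HNorm s (J k) ^ 2)
      (fun _ _ => sq_nonneg _) (Finset.mem_univ k)

/-- Lemma 2.7: `∥(j·∇)u∥_{H^{s−1}} ≤ C ∥j∥_{H^s} ∥∇u∥_{H^{s'}}`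
for `s > 3/2`, `s−1 ≤ s' ≤ s+1` and Schwartz vector fields `j, u`. -/
theorem advection_estimate_ju (s s' : ℝ) (hs : 3 / 2 < s)
    (hs'1 : s - 1 ≤ s') (hs'2 : s' ≤ s + 1) :
    ∃ C : ℝ, 0 < C ∧ ∀ j u : Fin 3 → SchwartzMap E3 ℝ,
      VNorm (s - 1) (adv (toVF j) (toVF u)) ≤
        C * VNorm s (toVF j) * GradVNorm s' (toVF u) := by
  have hσ : 0 ≤ s - 1 := by linarith
  have hI : 0 ≤ ∫ x : E3, (1 + ‖x‖ ^ 2) ^ (-s) := integral_nonneg fun x => by positivity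
  set K : ℝ := 3 * (4 ^ (s - 1) * (2 * ∫ x : E3, (1 + ‖x‖ ^ 2) ^ (-s))) with hK
  have hK0 : 0 ≤ K := by positivity
  refine ⟨√K + 1, by positivity, fun j u => ?_⟩
  set A : ℝ := ∑ k, HNormR s (toVF j k) ^ 2 with hA
  set B : ℝ := ∑ i, ∑ k, HNormR s' (pdR k (toVF u i)) ^ 2 with hB
  have hA0 : 0 ≤ A := Finset.sum_nonneg fun _ _ => sq_nonneg _
  have hB0 : 0 ≤ B := Finset.sum_nonneg fun _ _ => Finset.sum_nonneg fun _ _ => sq_nonneg _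
  have h : ∑ i, HNormR (s - 1) (adv (toVF j) (toVF u) i) ^ 2 ≤ K * (A * B) := by
    rw [hB, Finset.mul_sum, Finset.mul_sum]
    exact Finset.sum_le_sum fun i _ => HNormR_adv_sq_le_s6 hs hσ (by linarith) hs'1 j u i
  rw [VNorm, VNorm, GradVNorm, ← hA, ← hB]
  simp_rw [← Real.sqrt_eq_rpow]
  clear_value K A B
  calc _ ≤ √(K * (A * B)) := Real.sqrt_le_sqrt h
    _ = √K * √A * √B := by rw [Real.sqrt_mul hK0, Real.sqrt_mul hA0, mul_assoc]
    _ ≤ (√K + 1) * √A * √B := by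
      rw [mul_assoc, mul_assoc]
      exact mul_le_mul_of_nonneg_right (le_add_of_nonneg_right zero_le_one) (by positivity)

end
end
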